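/- Let 1 < β < 2, α_k = (−1)^k binom(β,k) and θ_k = 2^{−β} binom(β,k). Define B_n = (1/Γ(β+2)) ∑_{k=0}^{n} α_{n−k} k^{β+1} − ∑_{k=0}^{n} θ_{n−k} k. Then there exists a constant C > 0 such that |B_n| ≤ C n^{−1} for all integers n ≥ 1. -/

import Mathlib

/-- The generalized binomial coefficient `binom(β,k) = β(β−1)⋯(β−k+1)/k!`. -/
noncomputable def gbinom (β : ℝ) (k : ℕ) : ℝ :=
  (∏ i ∈ Finset.range k, (β - i)) / (Nat.factorial k)

open Filter Topology Finset

lemma gbinom_zero (γ : ℝ) : gbinom γ 0 = 1 := by simp [gbinom]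

lemma gbinom_succ (γ : ℝ) (n : ℕ) :
    ((n : ℝ) + 1) * gbinom γ (n + 1) = (γ - n) * gbinom γ n := by
  have h : (n : ℝ) + 1 ≠ 0 := by positivity
  have h' : (n.factorial : ℝ) ≠ 0 := by positivity
  simp only [gbinom, prod_range_succ, Nat.factorial_succ, Nat.cast_mul, Nat.cast_succ]
  field_simp

lemma gbinom_succ_eq_mul_sub_one (γ : ℝ) (n : ℕ) :
    ((n : ℝ) + 1) * gbinom γ (n + 1) = γ * gbinom (γ - 1) n := by
  have h : (n : ℝ) + 1 ≠ 0 := by positivity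
  have h' : (n.factorial : ℝ) ≠ 0 := by positivity
  have hp : ∏ i ∈ range n, (γ - ((i + 1 : ℕ) : ℝ)) = ∏ i ∈ range n, (γ - 1 - (i : ℝ)) :=
    prod_congr rfl fun i _ => by push_cast; ring
  simp only [gbinom, prod_range_succ', hp, Nat.factorial_succ, Nat.cast_mul]
  push_cast
  field_simp
  ring

lemma mul_abs_gbinom_succ (γ : ℝ) (n : ℕ) :
    ((n : ℝ) + 1) * |gbinom γ (n + 1)| = |γ| * |gbinom (γ - 1) n| := by
  rw [← abs_mul, ← gbinom_succ_eq_mul_sub_one, abs_mul,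
    abs_of_nonneg (by positivity : (0 : ℝ) ≤ n + 1)]

lemma gbinom_eq_choose (γ : ℝ) (n : ℕ) : gbinom γ n = Ring.choose γ n := by
  induction n with
  | zero => simp [gbinom_zero]
  | succ n ih =>
    have h : (n : ℝ) + 1 ≠ 0 := by positivity
    have h1 := gbinom_succ γ n
    have h2 := Ring.choose_smul_choose γ (Nat.le_succ n)
    simp at h2
    rw [ih] at h1
    apply mul_left_cancel₀ h
    rw [h1, h2]
    ring

/-- Vandermonde convolution for generalized binomial coefficients. -/
lemma sum_gbinom_mul_gbinom (a b : ℝ) (n : ℕ) :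
    ∑ k ∈ range (n + 1), gbinom a (n - k) * gbinom b k = gbinom (a + b) n := by
  simp only [gbinom_eq_choose]
  rw [add_comm a b, Ring.add_choose_eq n (Commute.all b a),
    Nat.sum_antidiagonal_eq_sum_range_succ (fun i j => Ring.choose b i * Ring.choose a j)]
  exact sum_congr rfl fun k _ => mul_comm _ _

/-- The Taylor coefficients of `(1 - z) ^ (-γ)`. -/
noncomputable def risingCoeff (γ : ℝ) (k : ℕ) : ℝ := (-1) ^ k * gbinom (-γ) k

lemma risingCoeff_zero (γ : ℝ) : risingCoeff γ 0 = 1 := by simp [risingCoeff, gbinom_zero]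

lemma risingCoeff_succ (γ : ℝ) (k : ℕ) :
    ((k : ℝ) + 1) * risingCoeff γ (k + 1) = (γ + k) * risingCoeff γ k := by
  have h := gbinom_succ (-γ) k
  simp only [risingCoeff, pow_succ]
  linear_combination (-(-1) ^ k) * h

lemma mul_risingCoeff_add_one (γ : ℝ) (k : ℕ) :
    γ * risingCoeff (γ + 1) k = (γ + k) * risingCoeff γ k := by
  have h := gbinom_succ_eq_mul_sub_one (-γ) k
  have h' := gbinom_succ (-γ) k
  have e : -(γ + 1) = -γ - 1 := by ring
  simp only [risingCoeff, e]
  linear_combination (-1) ^ k * h - (-1) ^ k * h'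

lemma sum_gbinom_mul_risingCoeff (β γ : ℝ) (n : ℕ) :
    ∑ k ∈ range (n + 1), (-1 : ℝ) ^ (n - k) * gbinom β (n - k) * risingCoeff γ k
      = risingCoeff (γ - β) n := by
  have e : -(γ - β) = β + -γ := by ring
  rw [risingCoeff, e, ← sum_gbinom_mul_gbinom, mul_sum]
  refine sum_congr rfl fun k hk => ?_
  have hk' : n - k + k = n := Nat.sub_add_cancel (Nat.lt_succ_iff.mp (mem_range.mp hk))
  rw [← hk', pow_add, hk', risingCoeff]
  ring

lemma risingCoeff_two (n : ℕ) : risingCoeff 2 n = n + 1 := by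
  induction n with
  | zero => simp [risingCoeff_zero]
  | succ n ih =>
    have h := risingCoeff_succ 2 n
    rw [ih] at h
    have h0 : (n : ℝ) + 1 ≠ 0 := by positivity
    apply mul_left_cancel₀ h0
    rw [h]; push_cast; ring

lemma risingCoeff_one (n : ℕ) : risingCoeff 1 n = 1 := by
  have h := mul_risingCoeff_add_one 1 n
  have h0 : (n : ℝ) + 1 ≠ 0 := by positivity
  norm_num [risingCoeff_two] at h
  apply mul_left_cancel₀ h0
  linear_combination -h

lemma risingCoeff_zero_left {n : ℕ} (hn : 1 ≤ n) : risingCoeff 0 n = 0 := by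
  have h := mul_risingCoeff_add_one 0 n
  have h0 : (n : ℝ) ≠ 0 := by positivity
  simpa [h0] using h

lemma abs_risingCoeff_neg_one_le {n : ℕ} (hn : 1 ≤ n) :
    |risingCoeff (-1) n| ≤ (n : ℝ)⁻¹ := by
  have h := mul_risingCoeff_add_one (-1) n
  norm_num [risingCoeff_zero_left hn] at h
  rcases h with h | h
  · have h1 : n = 1 := by
      have : (n : ℝ) = 1 := by linarith
      exact_mod_cast this
    subst h1
    have := risingCoeff_succ (-1) 0
    norm_num [risingCoeff_zero] at this
    simp [this]
  · rw [h, abs_zero]; positivity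

/-- Taylor expansion of `(1 + x) ^ γ`, with the remainder bounded by the first omitted term. -/
lemma abs_one_add_rpow_sub_sum_le (n : ℕ) (γ : ℝ) (hγ : γ ≤ n) {x : ℝ} (hx : 0 ≤ x) :
    |(1 + x) ^ γ - ∑ j ∈ range n, gbinom γ j * x ^ j| ≤ |gbinom γ n| * x ^ n := by
  induction n generalizing γ x with
  | zero =>
    have h1 : (1 + x) ^ γ ≤ 1 :=
      Real.rpow_le_one_of_one_le_of_nonpos (by linarith) (by simpa using hγ)
    simpa [gbinom_zero, abs_of_nonneg (Real.rpow_nonneg (by linarith : 0 ≤ 1 + x) γ)] using h1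
  | succ n ih =>
    have hγ' : γ - 1 ≤ n := by push_cast at hγ; linarith
    have hd : ∀ y : ℝ, 0 ≤ y → HasDerivAt
        (fun y : ℝ => (1 + y) ^ γ - ∑ j ∈ range (n + 1), gbinom γ j * y ^ j)
        (γ * ((1 + y) ^ (γ - 1) - ∑ j ∈ range n, gbinom (γ - 1) j * y ^ j)) y := by
      intro y hy
      have h1 : HasDerivAt (fun y : ℝ => (1 + y) ^ γ) (γ * (1 + y) ^ (γ - 1)) y := by
        have := ((hasDerivAt_id y).const_add 1).rpow_const (p := γ)
          (Or.inl (by simp only [id]; linarith))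
        simpa [mul_comm] using this
      have h2 : HasDerivAt (fun y : ℝ => ∑ j ∈ range (n + 1), gbinom γ j * y ^ j)
          (∑ j ∈ range (n + 1), gbinom γ j * (j * y ^ (j - 1))) y :=
        HasDerivAt.fun_sum fun j _ => (hasDerivAt_pow j y).const_mul _
      refine (h1.sub h2).congr_deriv ?_
      rw [sum_range_succ', mul_sub, mul_sum]
      congr 1
      simp only [Nat.cast_zero, zero_mul, mul_zero, add_zero]
      refine sum_congr rfl fun j _ => ?_
      have := gbinom_succ_eq_mul_sub_one γ j
      push_cast
      linear_combination y ^ j * this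
    have hB : ∀ y : ℝ, HasDerivAt (fun y : ℝ => |gbinom γ (n + 1)| * y ^ (n + 1))
        (|gbinom γ (n + 1)| * ((n + 1 : ℕ) * y ^ n)) y := fun y =>
      (hasDerivAt_pow (n + 1) y).const_mul _
    have key := image_norm_le_of_norm_deriv_right_le_deriv_boundary (a := 0) (b := x)
      (f := fun y : ℝ => (1 + y) ^ γ - ∑ j ∈ range (n + 1), gbinom γ j * y ^ j)
      (fun y hy => (hd y hy.1).continuousAt.continuousWithinAt)
      (fun y hy => (hd y hy.1).hasDerivWithinAt)
      (B := fun y : ℝ => |gbinom γ (n + 1)| * y ^ (n + 1))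
      (by simp [sum_range_succ', gbinom_zero]) hB ?_ (x := x) ⟨hx, le_rfl⟩
    · simpa using key
    · intro y hy
      rw [Real.norm_eq_abs, abs_mul]
      have h1 := ih (γ - 1) hγ' hy.1
      have h2 := mul_abs_gbinom_succ γ n
      calc _ ≤ |γ| * (|gbinom (γ - 1) n| * y ^ n) := by gcongr
        _ = _ := by push_cast; linear_combination (-y ^ n) * h2

lemma abs_gbinom_le {β : ℝ} (hβ1 : 1 < β) (hβ2 : β < 2) (n : ℕ) :
    |gbinom β n| ≤ 9 / ((n : ℝ) + 1) ^ 2 := by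
  have g1 : gbinom β 1 = β := by
    have := gbinom_succ β 0; simpa [gbinom_zero] using this
  have g2 : 2 * gbinom β 2 = (β - 1) * β := by
    have := gbinom_succ β 1
    rw [g1] at this
    norm_num at this
    linarith
  have h : ∀ m : ℕ, ((m : ℝ) + 2) * (m + 1) * |gbinom β (m + 2)| ≤ 2 := by
    intro m
    induction m with
    | zero =>
      rw [zero_add, abs_of_nonneg (by nlinarith)]
      push_cast
      nlinarith
    | succ m ih =>
      have h1 := gbinom_succ β (m + 2)
      have h2 : ((m : ℝ) + 3) * |gbinom β (m + 3)| = (m + 2 - β) * |gbinom β (m + 2)| := by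
        have h3 := congrArg abs h1
        rw [abs_mul, abs_mul, abs_of_nonneg (by positivity : (0 : ℝ) ≤ (m + 2 : ℕ) + 1),
          abs_of_nonpos (by push_cast; linarith [(Nat.cast_nonneg m : (0 : ℝ) ≤ m)] :
            β - ((m + 2 : ℕ) : ℝ) ≤ 0)] at h3
        push_cast at h3
        rw [show m + 3 = m + 2 + 1 from rfl]
        linear_combination h3
      have h4 : (m + 2 - β) * |gbinom β (m + 2)| ≤ (m + 1) * |gbinom β (m + 2)| := by
        gcongr; linarith
      rw [show m + 1 + 2 = m + 3 from rfl]
      push_cast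
      nlinarith [mul_le_mul_of_nonneg_left (h2.le.trans h4) (by positivity : (0 : ℝ) ≤ m + 2)]
  rcases n with _ | _ | m
  · norm_num [gbinom_zero]
  · norm_num [g1, abs_of_pos (by linarith : 0 < β)]; linarith
  · rw [le_div_iff₀ (by positivity)]
    have := h m
    rw [show m + 1 + 1 = m + 2 from rfl]
    push_cast
    have hm : (0 : ℝ) ≤ m := Nat.cast_nonneg m
    have h5 : ((m : ℝ) + 1 + 1 + 1) ^ 2 ≤ 9 / 2 * ((m + 2) * (m + 1)) := by nlinarith
    nlinarith [mul_le_mul_of_nonneg_left h5 (abs_nonneg (gbinom β (m + 2)))]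

lemma abs_sum_gbinom_mul_sub_le {β : ℝ} (hβ1 : 1 < β) (hβ2 : β < 2) {n : ℕ} (hn : 1 ≤ n) :
    |∑ k ∈ range (n + 1), 2 ^ (-β) * gbinom β (n - k) * (k : ℝ) - (n - β / 2)|
      ≤ 18 * (n : ℝ)⁻¹ := by
  have hn' : (1 : ℝ) ≤ n := by exact_mod_cast hn
  have h1 := abs_one_add_rpow_sub_sum_le (n + 1) β (by push_cast; linarith) zero_le_one
  have h2 := abs_one_add_rpow_sub_sum_le n (β - 1) (by linarith) zero_le_one
  simp only [one_pow, mul_one] at h1 h2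
  norm_num at h1 h2
  have hb := abs_gbinom_le hβ1 hβ2 (n + 1)
  have h3 : |β * (2 ^ (β - 1) - ∑ j ∈ range n, gbinom (β - 1) j)|
      ≤ ((n : ℝ) + 1) * |gbinom β (n + 1)| := by
    rw [mul_abs_gbinom_succ, abs_mul]
    gcongr
  have hp : (2 : ℝ) ^ (-β) * 2 ^ β = 1 := by
    rw [← Real.rpow_add two_pos]; simp
  have hp' : (2 : ℝ) ^ (β - 1) = 2 ^ β / 2 := by
    rw [Real.rpow_sub two_pos]; simp
  have hle : (2 : ℝ) ^ (-β) ≤ 1 :=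
    Real.rpow_le_one_of_one_le_of_nonpos (by norm_num) (by linarith)
  have hpos : (0 : ℝ) < 2 ^ (-β) := by positivity
  have hs : ∑ k ∈ range (n + 1), 2 ^ (-β) * gbinom β (n - k) * (k : ℝ)
      = 2 ^ (-β) * (n * ∑ j ∈ range (n + 1), gbinom β j
        - β * ∑ j ∈ range n, gbinom (β - 1) j) := by
    have e1 : β * ∑ j ∈ range n, gbinom (β - 1) j
        = ∑ j ∈ range (n + 1), (j : ℝ) * gbinom β j := by
      rw [sum_range_succ', mul_sum]
      simp only [← gbinom_succ_eq_mul_sub_one]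
      simp
    rw [e1, mul_sum, ← sum_sub_distrib, mul_sum, ← sum_range_reflect]
    refine sum_congr rfl fun k hk => ?_
    have hk' : k ≤ n := Nat.lt_succ_iff.mp (mem_range.mp hk)
    have e2 : n + 1 - 1 - k = n - k := by omega
    rw [e2, Nat.sub_sub_self hk', Nat.cast_sub hk']
    ring
  have hfin : ∑ k ∈ range (n + 1), 2 ^ (-β) * gbinom β (n - k) * (k : ℝ) - (n - β / 2)
      = 2 ^ (-β) * (β * (2 ^ (β - 1) - ∑ j ∈ range n, gbinom (β - 1) j)
        - n * (2 ^ β - ∑ j ∈ range (n + 1), gbinom β j)) := by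
    rw [hs, hp']
    linear_combination (n - β / 2) * hp
  rw [hfin, abs_mul, abs_of_pos hpos]
  have hA : ((n : ℝ) + 1) * |gbinom β (n + 1)| ≤ 9 * (n : ℝ)⁻¹ := by
    calc _ ≤ ((n : ℝ) + 1) * (9 / (((n + 1 : ℕ) : ℝ) + 1) ^ 2) := by gcongr
      _ ≤ _ := by
        rw [← div_eq_mul_inv, ← mul_div_assoc, div_le_div_iff₀ (by positivity) (by positivity)]
        push_cast
        nlinarith
  have hB : |(n : ℝ) * (2 ^ β - ∑ j ∈ range (n + 1), gbinom β j)|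
      ≤ ((n : ℝ) + 1) * |gbinom β (n + 1)| := by
    rw [abs_mul, Nat.abs_cast]
    gcongr
    linarith
  calc _ ≤ 1 * (9 * (n : ℝ)⁻¹ + 9 * (n : ℝ)⁻¹) := by
        gcongr
        exact (abs_sub _ _).trans (add_le_add (h3.trans hA) (hB.trans hA))
    _ = _ := by ring

lemma risingCoeff_eq_prod (γ : ℝ) (n : ℕ) :
    risingCoeff γ n = (∏ i ∈ range n, (γ + i)) / n.factorial := by
  induction n with
  | zero => simp [risingCoeff_zero]
  | succ n ih =>
    have h := risingCoeff_succ γ n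
    have h0 : (n : ℝ) + 1 ≠ 0 := by positivity
    have h' : (n.factorial : ℝ) ≠ 0 := by positivity
    apply mul_left_cancel₀ h0
    rw [h, ih, prod_range_succ, Nat.factorial_succ]
    push_cast
    field_simp

lemma tendsto_risingCoeff_div_rpow {γ : ℝ} (hγ : 0 < γ) :
    Tendsto (fun n : ℕ => risingCoeff γ n / (n : ℝ) ^ (γ - 1)) atTop
      (𝓝 (1 / Real.Gamma γ)) := by
  have h := ((Real.GammaSeq_tendsto_Gamma γ).inv₀ (Real.Gamma_pos_of_pos hγ).ne').mul
    (tendsto_natCast_div_add_atTop γ)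
  rw [mul_one, ← one_div] at h
  refine h.congr' ?_
  filter_upwards [eventually_gt_atTop 0] with n hn
  have hn' : (0 : ℝ) < n := by exact_mod_cast hn
  have hp : (∏ i ∈ range n, (γ + i)) ≠ 0 := (prod_pos fun i _ => by positivity).ne'
  have h' : (n.factorial : ℝ) ≠ 0 := by positivity
  have h1 : (n : ℝ) ^ γ ≠ 0 := by positivity
  have h2 : (n : ℝ) + γ ≠ 0 := by positivity
  rw [risingCoeff_eq_prod, Real.GammaSeq, prod_range_succ, Real.rpow_sub_one hn'.ne',
    add_comm γ (n : ℝ)]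
  field_simp

/-- A sequence whose increments are dominated by those of a null sequence `u`
is within `u` of its limit. -/
lemma abs_sub_le_of_abs_succ_sub_le {y u : ℕ → ℝ} {L : ℝ} (hy : Tendsto y atTop (𝓝 L))
    (hu : Tendsto u atTop (𝓝 0)) (h : ∀ k, |y (k + 1) - y k| ≤ u k - u (k + 1)) (k : ℕ) :
    |L - y k| ≤ u k := by
  have h1 : Antitone fun k => y k + u k := antitone_nat_of_succ_le fun k => by
    linarith [(abs_le.mp (h k)).2]
  have h2 : Monotone fun k => y k - u k := monotone_nat_of_le_succ fun k => by
    linarith [(abs_le.mp (h k)).1]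
  have h3 := h1.le_of_tendsto (by simpa using hy.add hu) k
  have h4 := h2.ge_of_tendsto (by simpa using hy.sub hu) k
  rw [abs_le]
  constructor <;> linarith

lemma abs_cubic_le (p₀ p₁ p₂ p₃ : ℝ) {t : ℝ} (ht0 : 0 ≤ t) (ht1 : t ≤ 1) :
    |p₀ + p₁ * t + p₂ * t ^ 2 + p₃ * t ^ 3| ≤ |p₀| + |p₁| + |p₂| + |p₃| := by
  have h : ∀ (p : ℝ) (n : ℕ), |p * t ^ n| ≤ |p| := fun p n => by
    rw [abs_mul, abs_of_nonneg (pow_nonneg ht0 n)]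
    exact mul_le_of_le_one_right (abs_nonneg p) (pow_le_one₀ ht0 ht1)
  have h1 := h p₁ 1
  rw [pow_one] at h1
  refine (abs_add_le _ _).trans (add_le_add ((abs_add_le _ _).trans (add_le_add
    ((abs_add_le _ _).trans (add_le_add le_rfl h1)) (h p₂ 2))) (h p₃ 3))

/-- The second-order coefficient in the expansion of `k ^ (β + 1) / Γ (β + 2)` in terms of
`risingCoeff`. -/
noncomputable def coeffTwo (β : ℝ) : ℝ := -(β + 2) / 3 + (β + 2) * (β + 3) / 8

/-- The third-order coefficient in the expansion of `k ^ (β + 1) / Γ (β + 2)` in terms of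
`risingCoeff`. -/
noncomputable def coeffThree (β : ℝ) : ℝ :=
  -(β + 2) / 4 + (β + 2) * (β + 3) / 6 - (β + 2) * (β + 3) * (β + 4) / 48

/-- The partial expansion of `k ^ (β + 1) / Γ (β + 2)` in terms of `risingCoeff`. -/
noncomputable def powApprox (β : ℝ) (k : ℕ) : ℝ :=
  risingCoeff (β + 2) k - (β + 2) / 2 * risingCoeff (β + 1) k
    + coeffTwo β * risingCoeff β k + coeffThree β * risingCoeff (β - 1) k

/-- The polynomial `(β - 1) β (β + 1) * powApprox β x / risingCoeff (β - 1) x`. -/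
noncomputable def approxPoly (β x : ℝ) : ℝ :=
  (x + β - 1) * (x + β) * (x + β + 1) - (β + 2) / 2 * (β + 1) * ((x + β - 1) * (x + β))
    + coeffTwo β * (β * (β + 1)) * (x + β - 1) + coeffThree β * ((β - 1) * β * (β + 1))

lemma powApprox_eq (β : ℝ) (k : ℕ) :
    (β - 1) * β * (β + 1) * powApprox β k = approxPoly β k * risingCoeff (β - 1) k := by
  have h1 := mul_risingCoeff_add_one (β - 1) k
  have h2 := mul_risingCoeff_add_one β k
  have h3 := mul_risingCoeff_add_one (β + 1) k
  rw [sub_add_cancel] at h1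
  rw [show β + 1 + 1 = β + 2 by ring] at h3
  simp only [powApprox, approxPoly]
  linear_combination (β - 1) * β * h3
    + ((β - 1) * (β + 1 + k) - (β + 2) / 2 * (β - 1) * (β + 1)) * h2
    + ((β + 1 + k) * (β + k) - (β + 2) / 2 * (β + 1) * (β + k) + coeffTwo β * β * (β + 1)) * h1

lemma exists_abs_approxPoly_succ_sub_le (β : ℝ) (hβ : β ≤ 4) :
    ∃ C, ∀ x : ℝ, 1 ≤ x → |(x + β - 1) * approxPoly β (x + 1)
      - (1 + x⁻¹) ^ (β + 1) * ((x + 1) * approxPoly β x)| ≤ C * x⁻¹ := by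
  set a₂ := coeffTwo β with ha₂
  set a₃ := coeffThree β with ha₃
  set u₁ := 3 * β - (β + 2) / 2 * (β + 1) with hu₁
  set u₂ := 3 * β ^ 2 - 1 - (β + 2) / 2 * (β + 1) * (2 * β - 1) + a₂ * (β * (β + 1)) with hu₂
  set u₃ := β * (β ^ 2 - 1) - (β + 2) / 2 * (β + 1) * ((β - 1) * β)
    + a₂ * (β * (β + 1)) * (β - 1) + a₃ * ((β - 1) * β * (β + 1)) with hu₃
  set b := gbinom (β + 1) with hb
  have b0 : b 0 = 1 := gbinom_zero _
  have b1 : b 1 = β + 1 := by simp [hb, gbinom]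
  have b2 : b 2 = (β + 1) * β / 2 := by simp [hb, gbinom, prod_range_succ]
  have b3 : b 3 = (β + 1) * β * (β - 1) / 6 := by
    simp only [hb, gbinom, prod_range_succ, prod_range_zero, Nat.factorial]; push_cast; ring
  have b4 : b 4 = (β + 1) * β * (β - 1) * (β - 2) / 24 := by
    simp only [hb, gbinom, prod_range_succ, prod_range_zero, Nat.factorial]; push_cast; ring
  set p₀ := -(u₃ * b 1 + (u₂ + u₃) * b 2 + (u₁ + u₂) * b 3 + (1 + u₁) * b 4) with hp₀
  set p₁ := -(u₃ * b 2 + (u₂ + u₃) * b 3 + (u₁ + u₂) * b 4) with hp₁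
  set p₂ := -(u₃ * b 3 + (u₂ + u₃) * b 4) with hp₂
  set p₃ := -(u₃ * b 4) with hp₃
  refine ⟨|p₀| + |p₁| + |p₂| + |p₃| + |b 5| * (2 * (|1| + |u₁| + |u₂| + |u₃|)), fun x hx => ?_⟩
  have hx0 : 0 < x := by linarith
  set t := x⁻¹ with ht
  have ht0 : 0 < t := inv_pos.mpr hx0
  have ht1 : t ≤ 1 := inv_le_one_of_one_le₀ hx
  have htx : t * x = 1 := inv_mul_cancel₀ hx0.ne'
  have hxt : x = t⁻¹ := by rw [ht, inv_inv]
  have hT := abs_one_add_rpow_sub_sum_le 5 (β + 1) (by push_cast; linarith) ht0.le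
  rw [← hb] at hT
  set T := ∑ j ∈ range 5, b j * t ^ j with hTdef
  have hG : t ^ 4 * ((x + 1) * approxPoly β x)
      = (1 + t) * (1 + u₁ * t + u₂ * t ^ 2 + u₃ * t ^ 3) := by
    rw [hxt, approxPoly, hu₁, hu₂, hu₃]
    field_simp
    ring
  have hH : t ^ 4 * ((x + β - 1) * approxPoly β (x + 1))
      = T * ((1 + t) * (1 + u₁ * t + u₂ * t ^ 2 + u₃ * t ^ 3))
        + t ^ 5 * (p₀ + p₁ * t + p₂ * t ^ 2 + p₃ * t ^ 3) := by
    have hq : t ^ 4 * ((x + β - 1) * approxPoly β (x + 1))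
        = (1 + (β - 1) * t) * ((1 + β * t) * (1 + (β + 1) * t) * (1 + (β + 2) * t)
          - (β + 2) / 2 * (β + 1) * t * ((1 + β * t) * (1 + (β + 1) * t))
          + a₂ * (β * (β + 1)) * t ^ 2 * (1 + β * t)
          + a₃ * ((β - 1) * β * (β + 1)) * t ^ 3) := by
      rw [hxt, approxPoly]
      field_simp
      ring
    rw [hq, hTdef]
    simp only [sum_range_succ, sum_range_zero, hp₀, hp₁, hp₂, hp₃, b0, b1, b2, b3, b4]
    simp only [hu₁, hu₂, hu₃, ha₂, ha₃, coeffTwo, coeffThree]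
    ring
  have hU := abs_cubic_le 1 u₁ u₂ u₃ ht0.le ht1
  have hP := abs_cubic_le p₀ p₁ p₂ p₃ ht0.le ht1
  set U := 1 + u₁ * t + u₂ * t ^ 2 + u₃ * t ^ 3
  set P := p₀ + p₁ * t + p₂ * t ^ 2 + p₃ * t ^ 3
  have hE : t ^ 4 * ((x + β - 1) * approxPoly β (x + 1)
      - (1 + t) ^ (β + 1) * ((x + 1) * approxPoly β x))
      = t ^ 5 * P - ((1 + t) ^ (β + 1) - T) * ((1 + t) * U) := by
    linear_combination hH - (1 + t) ^ (β + 1) * hG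
  have ht4 : 0 < t ^ 4 := by positivity
  refine le_of_mul_le_mul_left ?_ ht4
  rw [← abs_of_pos ht4, ← abs_mul, abs_of_pos ht4, hE]
  have h1 : |t ^ 5 * P| ≤ t ^ 5 * (|p₀| + |p₁| + |p₂| + |p₃|) := by
    rw [abs_mul, abs_of_pos (by positivity : 0 < t ^ 5)]; gcongr
  have h2 : |((1 + t) ^ (β + 1) - T) * ((1 + t) * U)|
      ≤ (|b 5| * t ^ 5) * (2 * (|1| + |u₁| + |u₂| + |u₃|)) := by
    rw [abs_mul, abs_mul, abs_of_pos (by positivity : 0 < 1 + t)]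
    gcongr
    linarith
  refine (abs_sub _ _).trans ((add_le_add h1 h2).trans (le_of_eq ?_))
  ring

lemma tendsto_powApprox_div {β : ℝ} (hβ : 1 < β) :
    Tendsto (fun k : ℕ => powApprox β k / (k : ℝ) ^ (β + 1)) atTop
      (𝓝 (1 / Real.Gamma (β + 2))) := by
  have t0 : Tendsto (fun k : ℕ => ((k : ℝ))⁻¹) atTop (𝓝 0) := tendsto_inv_atTop_nhds_zero_nat
  have h0 := tendsto_risingCoeff_div_rpow (γ := β + 2) (by linarith)
  have h1 := (tendsto_risingCoeff_div_rpow (γ := β + 1) (by linarith)).mul t0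
  have h2 := (tendsto_risingCoeff_div_rpow (γ := β) (by linarith)).mul (t0.pow 2)
  have h3 := (tendsto_risingCoeff_div_rpow (γ := β - 1) (by linarith)).mul (t0.pow 3)
  have h := ((h0.sub (h1.const_mul ((β + 2) / 2))).add (h2.const_mul (coeffTwo β))).add
    (h3.const_mul (coeffThree β))
  norm_num at h
  rw [one_div]
  refine h.congr' ?_
  filter_upwards [eventually_gt_atTop 0] with n hn
  have hn' : (0 : ℝ) < n := by exact_mod_cast hn
  have e0 : (n : ℝ) ^ (β + 2 - 1) = n ^ (β + 1) := by congr 1; ring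
  have e1 : (n : ℝ) ^ β = n ^ (β + 1) / n := by
    rw [Real.rpow_add_one hn'.ne']; field_simp
  have e2 : (n : ℝ) ^ (β - 1) = n ^ (β + 1) / n ^ 2 := by
    rw [Real.rpow_sub_one hn'.ne', e1]; field_simp
  have e3 : (n : ℝ) ^ (β - 1 - 1) = n ^ (β + 1) / n ^ 3 := by
    rw [Real.rpow_sub_one hn'.ne', e2]; field_simp
  have hpos : (n : ℝ) ^ (β + 1) ≠ 0 := by positivity
  rw [e0, e1, e2, e3, powApprox]
  field_simp

lemma exists_abs_rpow_sub_powApprox_le {β : ℝ} (hβ1 : 1 < β) (hβ2 : β < 2) :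
    ∃ C, 0 ≤ C ∧ ∀ k : ℕ,
      |1 / Real.Gamma (β + 2) * (k : ℝ) ^ (β + 1) - powApprox β k| ≤ C / ((k : ℝ) + 1) := by
  obtain ⟨A, hA⟩ := exists_abs_approxPoly_succ_sub_le β (by linarith)
  obtain ⟨M, hM⟩ := (tendsto_risingCoeff_div_rpow (γ := β - 1) (by linarith)).abs.bddAbove_range
  have hM' : ∀ k : ℕ, |risingCoeff (β - 1) k / (k : ℝ) ^ (β - 1 - 1)| ≤ M := fun k =>
    hM (Set.mem_range_self k)
  have hM0 : 0 ≤ M := (abs_nonneg _).trans (hM' 0)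
  have hA0 : 0 ≤ A := by
    have := (abs_nonneg _).trans (hA 1 le_rfl)
    simpa using this
  set N := (β - 1) * β * (β + 1) with hN
  have hNpos : 0 < N := by
    have : 0 < β - 1 := by linarith
    positivity
  set D := 8 * (M * A / N) with hD
  have hD0 : 0 ≤ D := by positivity
  set L := 1 / Real.Gamma (β + 2) with hL
  set y : ℕ → ℝ := fun k => powApprox β k / (k : ℝ) ^ (β + 1) with hy
  have hstep : ∀ k : ℕ, 1 ≤ k → |y (k + 1) - y k| ≤ M * A / N / (k : ℝ) ^ 5 := by
    intro k hk
    have hk1 : (1 : ℝ) ≤ k := by exact_mod_cast hk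
    have hk0 : (0 : ℝ) < k := by linarith
    have hρ : ((k : ℝ) + 1) ^ (β + 1) = (1 + (k : ℝ)⁻¹) ^ (β + 1) * (k : ℝ) ^ (β + 1) := by
      rw [← Real.mul_rpow (by positivity) hk0.le]
      congr 1
      field_simp
    have hq := hA k hk1
    set ρ := (1 + (k : ℝ)⁻¹) ^ (β + 1)
    set Z := ((k : ℝ) + β - 1) * approxPoly β (k + 1) - ρ * ((k + 1) * approxPoly β k) with hZ
    have hm := risingCoeff_succ (β - 1) k
    have e1 := powApprox_eq β k
    have e2 := powApprox_eq β (k + 1)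
    rw [← hN] at e1 e2
    push_cast at e2
    have hρ0 : 0 < ρ := by positivity
    have hkp : (0 : ℝ) < (k : ℝ) ^ (β + 1) := by positivity
    have hdiff : y (k + 1) - y k
        = risingCoeff (β - 1) k * Z / (N * ((k + 1) * ((k : ℝ) + 1) ^ (β + 1))) := by
      have e3 : N * (k + 1) * (powApprox β (k + 1) - ρ * powApprox β k)
          = risingCoeff (β - 1) k * Z := by
        rw [hZ]
        linear_combination (k + 1) * e2 - (k + 1) * ρ * e1 + approxPoly β (k + 1) * hm
      simp only [hy]
      push_cast
      rw [← e3, hρ]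
      field_simp
    have hmk : |risingCoeff (β - 1) k| ≤ M * (k : ℝ) ^ (β - 2) := by
      have := hM' k
      rw [abs_div, abs_of_pos (by positivity : 0 < (k : ℝ) ^ (β - 1 - 1)),
        div_le_iff₀ (by positivity), show β - 1 - 1 = β - 2 by ring] at this
      exact this
    have hden : (k : ℝ) * (k : ℝ) ^ (β + 1) ≤ (k + 1) * ((k : ℝ) + 1) ^ (β + 1) := by
      gcongr <;> linarith
    rw [hdiff, abs_div, abs_mul,
      abs_of_pos (by positivity : 0 < N * ((k + 1) * ((k : ℝ) + 1) ^ (β + 1)))]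
    have hpw : (k : ℝ) ^ (β + 1) = (k : ℝ) ^ (β - 2) * (k : ℝ) ^ 3 := by
      rw [← Real.rpow_natCast, ← Real.rpow_add hk0]
      congr 1; push_cast; ring
    calc _ ≤ (M * (k : ℝ) ^ (β - 2)) * (A * (k : ℝ)⁻¹) / (N * (k * (k : ℝ) ^ (β + 1))) := by
          gcongr
      _ = _ := by
          have : (k : ℝ) ^ (β - 2) ≠ 0 := by positivity
          rw [hpw]; field_simp
  have htail : ∀ k : ℕ, |L - y (k + 1)| ≤ D / ((k : ℝ) + 1) ^ 4 := by
    have hu : Tendsto (fun k : ℕ => D / ((k : ℝ) + 1) ^ 4) atTop (𝓝 0) := by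
      have := (tendsto_one_div_add_atTop_nhds_zero_nat (𝕜 := ℝ)).pow 4 |>.const_mul D
      simpa [div_eq_mul_inv] using this
    refine abs_sub_le_of_abs_succ_sub_le (y := fun k => y (k + 1))
      ((tendsto_add_atTop_iff_nat 1).mpr (tendsto_powApprox_div hβ1)) hu fun k => ?_
    refine (hstep (k + 1) (by omega)).trans ?_
    push_cast
    have hs : (1 : ℝ) ≤ (k : ℝ) + 1 := by linarith [(Nat.cast_nonneg k : (0 : ℝ) ≤ k)]
    generalize (k : ℝ) + 1 = s at hs ⊢
    have hs0 : 0 < s := by linarith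
    have hpoly : 1 / s ^ 5 ≤ 8 * (1 / s ^ 4 - 1 / (s + 1) ^ 4) := by
      rw [div_sub_div _ _ (by positivity) (by positivity), ← mul_div_assoc,
        div_le_div_iff₀ (by positivity) (by positivity)]
      have h8 : (s + 1) ^ 4 ≤ 8 * s * ((s + 1) ^ 4 - s ^ 4) := by
        obtain ⟨r, rfl⟩ : ∃ r, s = 1 + r := ⟨s - 1, by ring⟩
        have hr : 0 ≤ r := by linarith
        have : 0 ≤ 8 * (1 + r) * ((1 + r + 1) ^ 4 - (1 + r) ^ 4) - (1 + r + 1) ^ 4 := by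
          ring_nf; positivity
        linarith
      nlinarith [mul_le_mul_of_nonneg_left h8 (by positivity : 0 ≤ s ^ 4)]
    have hMA : 0 ≤ M * A / N := by positivity
    have := mul_le_mul_of_nonneg_left hpoly hMA
    calc _ = M * A / N * (1 / s ^ 5) := by ring
      _ ≤ _ := this
      _ = _ := by rw [hD]; ring
  refine ⟨2 * D + |powApprox β 0|, by positivity, fun k => ?_⟩
  rcases k with _ | k
  · rw [Nat.cast_zero, Real.zero_rpow (by linarith)]
    simp only [mul_zero, zero_sub, abs_neg, zero_add, div_one]
    linarith
  · have h := htail k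
    push_cast
    set s := (k : ℝ) + 1 with hs
    have hs1 : (1 : ℝ) ≤ s := by linarith [(Nat.cast_nonneg k : (0 : ℝ) ≤ k)]
    have hs0 : 0 < s := by linarith
    have hsp : (0 : ℝ) < s ^ (β + 1) := by positivity
    have e : L * s ^ (β + 1) - powApprox β (k + 1) = s ^ (β + 1) * (L - y (k + 1)) := by
      simp only [hy]
      push_cast
      rw [← hs]
      field_simp
    have hle : s ^ (β + 1) ≤ s ^ 3 := by
      rw [← Real.rpow_natCast]
      exact Real.rpow_le_rpow_of_exponent_le hs1 (by push_cast; linarith)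
    rw [e, abs_mul, abs_of_pos hsp]
    calc _ ≤ s ^ 3 * (D / s ^ 4) := by gcongr
      _ = D / s := by field_simp
      _ ≤ (2 * D) / (s + 1) := by
        rw [div_le_div_iff₀ hs0 (by positivity)]
        nlinarith
      _ ≤ _ := by gcongr; linarith [abs_nonneg (powApprox β 0)]

lemma sum_one_div_sq_le (n : ℕ) :
    ∑ j ∈ range (n + 1), 1 / ((j : ℝ) + 1) ^ 2 ≤ 2 - 1 / ((n : ℝ) + 1) := by
  induction n with
  | zero => norm_num
  | succ n ih =>
    rw [sum_range_succ]
    have h : 1 / (((n + 1 : ℕ) : ℝ) + 1) ^ 2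
        ≤ 1 / ((n : ℝ) + 1) - 1 / (((n + 1 : ℕ) : ℝ) + 1) := by
      push_cast
      rw [div_sub_div _ _ (by positivity) (by positivity),
        div_le_div_iff₀ (by positivity) (by positivity)]
      nlinarith [(Nat.cast_nonneg n : (0 : ℝ) ≤ n)]
    linarith

lemma sum_one_div_sq_mul_one_div_le (n : ℕ) :
    ∑ k ∈ range (n + 1), 1 / (((n - k : ℕ) : ℝ) + 1) ^ 2 * (1 / ((k : ℝ) + 1))
      ≤ 3 / ((n : ℝ) + 1) := by
  have h1 : ∀ k ∈ range (n + 1),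
      1 / (((n - k : ℕ) : ℝ) + 1) ^ 2 * (1 / ((k : ℝ) + 1))
        ≤ 1 / ((n : ℝ) + 1) * (1 / (((n - k : ℕ) : ℝ) + 1) ^ 2 + 1 / ((n : ℝ) + 1)) := by
    intro k hk
    have hk' : k ≤ n := Nat.lt_succ_iff.mp (mem_range.mp hk)
    have hn : (n : ℝ) = ((n - k : ℕ) : ℝ) + k := by exact_mod_cast (Nat.sub_add_cancel hk').symm
    set j := ((n - k : ℕ) : ℝ)
    have hj : 0 ≤ j := Nat.cast_nonneg _
    have hk0 : (0 : ℝ) ≤ k := Nat.cast_nonneg _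
    rw [hn]
    have h2 : 1 / (j + 1) * (1 / ((k : ℝ) + 1)) ≤ 1 / (j + k + 1) := by
      rw [one_div_mul_one_div]
      apply one_div_le_one_div_of_le (by positivity)
      nlinarith [mul_nonneg hj hk0]
    have e : 1 / (j + 1) ^ 2 * (1 / ((k : ℝ) + 1))
        = 1 / (j + k + 2) * (1 / (j + 1) ^ 2 + 1 / (j + 1) * (1 / ((k : ℝ) + 1))) := by
      field_simp
      ring
    rw [e]
    gcongr
    linarith
  refine (sum_le_sum h1).trans ?_
  rw [← mul_sum, sum_add_distrib, sum_const, card_range]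
  have h2 : ∑ k ∈ range (n + 1), 1 / (((n - k : ℕ) : ℝ) + 1) ^ 2 ≤ 2 := by
    have := sum_range_reflect (fun j : ℕ => 1 / ((j : ℝ) + 1) ^ 2) (n + 1)
    simp only [Nat.add_sub_cancel] at this
    rw [this]
    have h3 : (0 : ℝ) ≤ 1 / ((n : ℝ) + 1) := by positivity
    linarith [sum_one_div_sq_le n]
  have h3 : (n + 1) • (1 / ((n : ℝ) + 1)) = 1 := by
    rw [nsmul_eq_mul]; push_cast; field_simp
  rw [h3, div_eq_mul_one_div 3, mul_comm 3]
  gcongr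
  linarith

lemma sum_gbinom_mul_powApprox (β : ℝ) {n : ℕ} (hn : 1 ≤ n) :
    ∑ k ∈ range (n + 1), (-1 : ℝ) ^ (n - k) * gbinom β (n - k) * powApprox β k
      = n - β / 2 + coeffThree β * risingCoeff (-1) n := by
  have h := sum_gbinom_mul_risingCoeff β
  have e : ∑ k ∈ range (n + 1), (-1 : ℝ) ^ (n - k) * gbinom β (n - k) * powApprox β k
      = risingCoeff (β + 2 - β) n - (β + 2) / 2 * risingCoeff (β + 1 - β) n
        + coeffTwo β * risingCoeff (β - β) n + coeffThree β * risingCoeff (β - 1 - β) n := by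
    simp only [← h, mul_sum, ← sum_add_distrib, ← sum_sub_distrib, powApprox]
    exact sum_congr rfl fun k _ => by ring
  rw [e, add_sub_cancel_left, add_sub_cancel_left, sub_self, risingCoeff_two, risingCoeff_one,
    risingCoeff_zero_left hn, show β - 1 - β = -1 by ring]
  ring

/-- For `1 < β < 2`, `α_k = (−1)^k binom(β,k)`, `θ_k = 2^{−β} binom(β,k)` and
`B_n = (1/Γ(β+2)) ∑_{k=0}^n α_{n−k} k^{β+1} − ∑_{k=0}^n θ_{n−k} k`, there is `C > 0` such that
`|B_n| ≤ C n^{−1}` for all `n ≥ 1`. -/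
theorem stmt_3 (β : ℝ) (hβ1 : 1 < β) (hβ2 : β < 2) :
    ∃ C > 0, ∀ n : ℕ, 1 ≤ n →
      |(1 / Real.Gamma (β + 2)) *
          ∑ k ∈ Finset.range (n + 1), (-1 : ℝ) ^ (n - k) * gbinom β (n - k) * (k : ℝ) ^ (β + 1)
        - ∑ k ∈ Finset.range (n + 1), 2 ^ (-β) * gbinom β (n - k) * (k : ℝ)| ≤ C * (n : ℝ)⁻¹ := by
  obtain ⟨C, hC0, hC⟩ := exists_abs_rpow_sub_powApprox_le hβ1 hβ2
  refine ⟨27 * C + |coeffThree β| + 18, by positivity, fun n hn => ?_⟩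
  have hn0 : (0 : ℝ) < n := by exact_mod_cast hn
  set S₁ := ∑ k ∈ range (n + 1), (-1 : ℝ) ^ (n - k) * gbinom β (n - k) *
    (1 / Real.Gamma (β + 2) * (k : ℝ) ^ (β + 1) - powApprox β k) with hS₁
  have hsplit : 1 / Real.Gamma (β + 2) *
      ∑ k ∈ range (n + 1), (-1 : ℝ) ^ (n - k) * gbinom β (n - k) * (k : ℝ) ^ (β + 1)
      = S₁ + (n - β / 2 + coeffThree β * risingCoeff (-1) n) := by
    rw [← sum_gbinom_mul_powApprox β hn, hS₁, ← sum_add_distrib, mul_sum]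
    exact sum_congr rfl fun k _ => by ring
  have h1 : |S₁| ≤ 27 * C * (n : ℝ)⁻¹ := by
    calc |S₁| ≤ ∑ k ∈ range (n + 1),
          9 * C * (1 / (((n - k : ℕ) : ℝ) + 1) ^ 2 * (1 / ((k : ℝ) + 1))) := by
          refine (abs_sum_le_sum_abs _ _).trans (sum_le_sum fun k _ => ?_)
          rw [abs_mul, abs_mul, abs_pow, abs_neg, abs_one, one_pow, one_mul]
          refine (mul_le_mul (abs_gbinom_le hβ1 hβ2 (n - k)) (hC k) (abs_nonneg _)
            (by positivity)).trans (le_of_eq ?_)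
          ring
      _ ≤ 9 * C * (3 / ((n : ℝ) + 1)) := by
          rw [← mul_sum]
          gcongr
          exact sum_one_div_sq_mul_one_div_le n
      _ ≤ 9 * C * (3 / (n : ℝ)) := by gcongr; linarith
      _ = _ := by ring
  have h2 : |coeffThree β * risingCoeff (-1) n| ≤ |coeffThree β| * (n : ℝ)⁻¹ := by
    rw [abs_mul]
    gcongr
    exact abs_risingCoeff_neg_one_le hn
  have h3 := abs_sum_gbinom_mul_sub_le hβ1 hβ2 hn
  rw [hsplit]
  rw [abs_le] at h1 h2 h3 ⊢
  constructor <;> linarith [h1.1, h1.2, h2.1, h2.2, h3.1, h3.2]
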